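/- arXiv:1704.06063 — 3 statements merged into one kernel-verified Lean document; each statement's English description precedes it below -/
import Mathlib

section
/- Let Ω ⊂ ℝⁿ be a smooth bounded domain, λ > 0, and let u be a smooth solution of -Δu = λeᵘ in Ω with u = 0 on ∂Ω that is stable, i.e., ∫_Ω λeᵘ ξ² dx ≤ ∫_Ω |∇ξ|² dx for all ξ ∈ C¹_c(Ω). Then for every α ∈ (0,2): (1 - α/2) ∫_Ω e^{(1+2α)u} dx ≤ 2 ∫_Ω e^{(1+α)u} dx. -/
open MeasureTheory

/-- The Laplacian of a function on ℝⁿ, as the sum of its pure second partial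
derivatives. -/
noncomputable def lap {n : ℕ} (u : EuclideanSpace ℝ (Fin n) → ℝ)
    (x : EuclideanSpace ℝ (Fin n)) : ℝ :=
  ∑ i : Fin n,
    fderiv ℝ (fun y => fderiv ℝ u y (EuclideanSpace.single i (1 : ℝ))) x
      (EuclideanSpace.single i (1 : ℝ))

open Filter Topology

/-- A continuous cutoff vanishing on `|s| ≤ 1 / k` and tending to `1` away from the origin
as `k → ∞`. -/
noncomputable def zeroCutoff (k : ℕ) (s : ℝ) : ℝ := min 1 (max 0 (k * |s| - 1))

lemma continuous_zeroCutoff (k : ℕ) : Continuous (zeroCutoff k) := by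
  unfold zeroCutoff
  fun_prop

lemma zeroCutoff_nonneg (k : ℕ) (s : ℝ) : 0 ≤ zeroCutoff k s :=
  le_min zero_le_one (le_max_left _ _)

lemma zeroCutoff_le_one (k : ℕ) (s : ℝ) : zeroCutoff k s ≤ 1 := min_le_left _ _

lemma zeroCutoff_eq_zero {k : ℕ} {s : ℝ} (h : k * |s| ≤ 1) : zeroCutoff k s = 0 := by
  unfold zeroCutoff
  rw [max_eq_left (by linarith)]
  exact min_eq_right zero_le_one

lemma tendsto_zeroCutoff {s : ℝ} (hs : s ≠ 0) :
    Tendsto (fun k => zeroCutoff k s) atTop (𝓝 1) := by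
  refine tendsto_const_nhds.congr' ?_
  have h : Tendsto (fun k : ℕ => (k : ℝ) * |s|) atTop atTop :=
    tendsto_natCast_atTop_atTop.atTop_mul_const (abs_pos.2 hs)
  filter_upwards [h.eventually_ge_atTop 2] with k hk
  unfold zeroCutoff
  rw [min_eq_left]
  exact le_max_of_le_right (by linarith)

/-- The antiderivative, vanishing at the origin, of `g` multiplied by a power of the cutoff. -/
noncomputable def cutoffPrimitive (m : ℕ) (g : ℝ → ℝ) (k : ℕ) (t : ℝ) : ℝ :=
  ∫ s in (0 : ℝ)..t, zeroCutoff k s ^ m * g s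

section cutoffPrimitive

variable {m : ℕ} {g : ℝ → ℝ}

lemma continuous_zeroCutoff_pow_mul (hg : Continuous g) (k : ℕ) :
    Continuous fun s => zeroCutoff k s ^ m * g s :=
  ((continuous_zeroCutoff k).pow m).mul hg

lemma deriv_cutoffPrimitive (hg : Continuous g) (k : ℕ) (t : ℝ) :
    deriv (cutoffPrimitive m g k) t = zeroCutoff k t ^ m * g t :=
  Continuous.deriv_integral _ (continuous_zeroCutoff_pow_mul hg k) 0 t

lemma contDiff_cutoffPrimitive (hg : Continuous g) (k : ℕ) :
    ContDiff ℝ 1 (cutoffPrimitive m g k) := by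
  have hc := continuous_zeroCutoff_pow_mul (m := m) hg k
  rw [contDiff_one_iff_deriv]
  refine ⟨fun t => (hc.integral_hasStrictDerivAt 0 t).hasDerivAt.differentiableAt, ?_⟩
  rwa [funext (deriv_cutoffPrimitive hg k)]

lemma cutoffPrimitive_eq_zero (hm : m ≠ 0) {k : ℕ} {t : ℝ} (ht : k * |t| ≤ 1) :
    cutoffPrimitive m g k t = 0 := by
  refine intervalIntegral.integral_zero_ae (Eventually.of_forall fun s hs => ?_)
  have hst : |s| ≤ |t| := by
    simpa using Set.abs_sub_left_of_mem_uIcc (Set.uIoc_subset_uIcc hs)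
  rw [zeroCutoff_eq_zero ((mul_le_mul_of_nonneg_left hst k.cast_nonneg).trans ht),
    zero_pow hm, zero_mul]

lemma abs_zeroCutoff_pow_mul_le (k : ℕ) (s : ℝ) : |zeroCutoff k s ^ m * g s| ≤ |g s| := by
  rw [abs_mul, abs_of_nonneg (pow_nonneg (zeroCutoff_nonneg k s) m)]
  exact mul_le_of_le_one_left (abs_nonneg _)
    (pow_le_one₀ (zeroCutoff_nonneg k s) (zeroCutoff_le_one k s))

lemma exists_abs_cutoffPrimitive_le (hg : Continuous g) (M : ℝ) :
    ∃ C, ∀ k t, |t| ≤ M → |cutoffPrimitive m g k t| ≤ C := by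
  obtain ⟨C, hC⟩ := (isCompact_Icc (a := -M) (b := M)).exists_bound_of_continuousOn hg.continuousOn
  refine ⟨|C| * M, fun k t ht => ?_⟩
  have h : ‖cutoffPrimitive m g k t‖ ≤ |C| * |t - 0| := by
    refine intervalIntegral.norm_integral_le_of_norm_le_const fun s hs => ?_
    have hst : |s| ≤ |t| := by
      simpa using Set.abs_sub_left_of_mem_uIcc (Set.uIoc_subset_uIcc hs)
    exact (abs_zeroCutoff_pow_mul_le k s).trans
      ((hC s (abs_le.1 (hst.trans ht))).trans (le_abs_self C))
  rw [sub_zero] at h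
  exact h.trans (mul_le_mul_of_nonneg_left ht (abs_nonneg _))

lemma tendsto_cutoffPrimitive (hg : Continuous g) (t : ℝ) :
    Tendsto (fun k => cutoffPrimitive m g k t) atTop (𝓝 (∫ s in (0 : ℝ)..t, g s)) := by
  refine intervalIntegral.tendsto_integral_filter_of_dominated_convergence (fun s => |g s|)
    (Eventually.of_forall fun k => (continuous_zeroCutoff_pow_mul hg k).aestronglyMeasurable)
    (Eventually.of_forall fun k => Eventually.of_forall fun s _ => abs_zeroCutoff_pow_mul_le k s)
    (hg.abs.intervalIntegrable _ _) ?_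
  filter_upwards [Measure.ae_ne volume (0 : ℝ)] with s hs _
  simpa using ((tendsto_zeroCutoff hs).pow m).mul_const (g s)

end cutoffPrimitive

lemma integral_mul_exp_mul {a : ℝ} (t : ℝ) :
    ∫ s in (0 : ℝ)..t, a * Real.exp (a * s) = Real.exp (a * t) - 1 := by
  have h : ∀ s ∈ Set.uIcc 0 t,
      HasDerivAt (fun s => Real.exp (a * s)) (a * Real.exp (a * s)) s := fun s _ => by
    simpa [mul_comm] using ((hasDerivAt_id s).const_mul a).exp
  rw [intervalIntegral.integral_eq_sub_of_hasDerivAt h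
    (Continuous.intervalIntegrable (by fun_prop) _ _)]
  simp

lemma tendsto_integral_comp_of_bounded {X : Type*} [MeasurableSpace X] {μ : Measure X}
    [IsFiniteMeasure μ] {u : X → ℝ} (hu : AEMeasurable u μ) {M C : ℝ}
    (hM : ∀ᵐ x ∂μ, |u x| ≤ M) {F : ℕ → ℝ → ℝ} {f : ℝ → ℝ} (hF : ∀ k, Continuous (F k))
    (hC : ∀ k t, |t| ≤ M → |F k t| ≤ C)
    (hlim : ∀ t, Tendsto (fun k => F k t) atTop (𝓝 (f t))) :
    Tendsto (fun k => ∫ x, F k (u x) ∂μ) atTop (𝓝 (∫ x, f (u x) ∂μ)) := by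
  refine tendsto_integral_of_dominated_convergence (fun _ => C)
    (fun k => ((hF k).measurable.comp_aemeasurable hu).aestronglyMeasurable)
    (integrable_const _) (fun k => ?_) (Eventually.of_forall fun x => hlim _)
  filter_upwards [hM] with x hx using hC k _ hx

section truncation

variable {E : Type*} [NormedAddCommGroup E] {Ω : Set E} {u : E → ℝ} {H : ℝ → ℝ}
  {ε : ℝ}

lemma tsupport_indicator_comp_subset (hu : Continuous u)
    (hH : ∀ t, |t| ≤ ε → H t = 0) :
    tsupport (Ω.indicator fun x => H (u x)) ⊆ closure Ω ∩ {x | ε ≤ |u x|} := by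
  refine closure_minimal (fun x hx => ?_)
    (isClosed_closure.inter (isClosed_le continuous_const hu.abs))
  rw [Function.mem_support, Set.indicator_apply_ne_zero] at hx
  exact ⟨subset_closure hx.1, le_of_not_ge fun h => hx.2 (hH _ h)⟩

lemma tsupport_indicator_comp_subset_self (hΩ : IsOpen Ω) (hu : Continuous u)
    (hbd : ∀ x ∈ frontier Ω, u x = 0) (hε : 0 < ε) (hH : ∀ t, |t| ≤ ε → H t = 0) :
    tsupport (Ω.indicator fun x => H (u x)) ⊆ Ω := by
  intro x hx
  obtain ⟨hxc, hxu⟩ := tsupport_indicator_comp_subset hu hH hx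
  by_contra hxΩ
  have h0 : u x = 0 := hbd x (by rw [hΩ.frontier_eq]; exact ⟨hxc, hxΩ⟩)
  simp only [Set.mem_ofPred_eq, h0, abs_zero] at hxu
  exact hxu.not_gt hε

lemma hasCompactSupport_indicator_comp [ProperSpace E] (hΩb : Bornology.IsBounded Ω)
    (hu : Continuous u) (hH : ∀ t, |t| ≤ ε → H t = 0) :
    HasCompactSupport (Ω.indicator fun x => H (u x)) :=
  hΩb.isCompact_closure.of_isClosed_subset (isClosed_tsupport _)
    ((tsupport_indicator_comp_subset hu hH).trans Set.inter_subset_left)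

variable [NormedSpace ℝ E]

lemma contDiff_indicator_comp (hΩ : IsOpen Ω) (hu : ContDiff ℝ 1 u)
    (hbd : ∀ x ∈ frontier Ω, u x = 0) (hHc : ContDiff ℝ 1 H) (hε : 0 < ε)
    (hH : ∀ t, |t| ≤ ε → H t = 0) :
    ContDiff ℝ 1 (Ω.indicator fun x => H (u x)) := by
  refine contDiff_iff_contDiffAt.2 fun x => ?_
  by_cases hx : x ∈ tsupport (Ω.indicator fun x => H (u x))
  swap
  · exact contDiffAt_const.congr_of_eventuallyEq (notMem_tsupport_iff_eventuallyEq.1 hx)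
  have hxΩ := tsupport_indicator_comp_subset_self hΩ hu.continuous hbd hε hH hx
  refine (hHc.comp hu).contDiffAt.congr_of_eventuallyEq ?_
  filter_upwards [hΩ.mem_nhds hxΩ] with y hy using Set.indicator_of_mem hy _

lemma fderiv_indicator_comp (hΩ : IsOpen Ω) (hu : ContDiff ℝ 1 u) (hHc : ContDiff ℝ 1 H) {x : E}
    (hx : x ∈ Ω) :
    fderiv ℝ (Ω.indicator fun x => H (u x)) x = deriv H (u x) • fderiv ℝ u x := by
  have h : Ω.indicator (fun x => H (u x)) =ᶠ[𝓝 x] H ∘ u := by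
    filter_upwards [hΩ.mem_nhds hx] with y hy using Set.indicator_of_mem hy _
  rw [h.fderiv_eq]
  exact (((hHc.differentiable one_ne_zero) _).hasDerivAt.comp_hasFDerivAt x
    ((hu.differentiable one_ne_zero) x).hasFDerivAt).fderiv

end truncation

section Euclidean

variable {n : ℕ} {Ω : Set (EuclideanSpace ℝ (Fin n))} {u : EuclideanSpace ℝ (Fin n) → ℝ}

lemma norm_gradient_sq_eq_sum (f : EuclideanSpace ℝ (Fin n) → ℝ) (x : EuclideanSpace ℝ (Fin n)) :
    ‖gradient f x‖ ^ 2 = ∑ i, fderiv ℝ f x (EuclideanSpace.single i (1 : ℝ)) ^ 2 := by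
  rw [EuclideanSpace.real_norm_sq_eq]
  refine Finset.sum_congr rfl fun i _ => ?_
  rw [← toDual_gradient, InnerProductSpace.toDual_apply_apply, EuclideanSpace.inner_single_right]
  simp

/-- Green's first identity for a compactly supported `C¹` function against a `C²` function. -/
lemma integral_sum_fderiv_mul_fderiv {w : EuclideanSpace ℝ (Fin n) → ℝ} (hw : ContDiff ℝ 1 w)
    (hwc : HasCompactSupport w) (hu : ContDiff ℝ 2 u) :
    ∫ x, ∑ i, fderiv ℝ w x (EuclideanSpace.single i (1 : ℝ)) *
        fderiv ℝ u x (EuclideanSpace.single i (1 : ℝ)) = ∫ x, w x * -lap u x := by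
  have hv (i : Fin n) : ContDiff ℝ 1 fun x => fderiv ℝ u x (EuclideanSpace.single i (1 : ℝ)) :=
    (hu.fderiv_right (m := 1) (by norm_num)).clm_apply contDiff_const
  have hw' (i : Fin n) : Continuous fun x => fderiv ℝ w x (EuclideanSpace.single i (1 : ℝ)) :=
    (hw.continuous_fderiv one_ne_zero).clm_apply continuous_const
  have hv' (i : Fin n) : Continuous fun x =>
      fderiv ℝ (fun y => fderiv ℝ u y (EuclideanSpace.single i (1 : ℝ))) x
        (EuclideanSpace.single i (1 : ℝ)) :=
    ((hv i).continuous_fderiv one_ne_zero).clm_apply continuous_const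
  have hi (i : Fin n) : Integrable fun x => fderiv ℝ w x (EuclideanSpace.single i (1 : ℝ)) *
      fderiv ℝ u x (EuclideanSpace.single i (1 : ℝ)) :=
    ((hw' i).mul (hv i).continuous).integrable_of_hasCompactSupport
      ((hwc.fderiv_apply ℝ _).mul_right)
  have hj (i : Fin n) : Integrable fun x => w x *
      fderiv ℝ (fun y => fderiv ℝ u y (EuclideanSpace.single i (1 : ℝ))) x
        (EuclideanSpace.single i (1 : ℝ)) :=
    (hw.continuous.mul (hv' i)).integrable_of_hasCompactSupport hwc.mul_right
  have hparts (i : Fin n) := integral_mul_fderiv_eq_neg_fderiv_mul_of_integrable (hi i) (hj i)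
    ((hw.continuous.mul (hv i).continuous).integrable_of_hasCompactSupport hwc.mul_right)
    (fun x _ => hw.differentiable one_ne_zero x) (fun x _ => (hv i).differentiable one_ne_zero x)
  simp only [lap, mul_neg, Finset.mul_sum, integral_neg]
  rw [integral_finsetSum _ fun i _ => hi i, integral_finsetSum _ fun i _ => hj i,
    ← Finset.sum_neg_distrib]
  exact Finset.sum_congr rfl fun i _ => by rw [hparts i, neg_neg]

lemma setIntegral_deriv_mul_norm_gradient_sq (hΩ : IsOpen Ω) (hΩb : Bornology.IsBounded Ω)
    (hu : ContDiff ℝ 2 u) (hbd : ∀ x ∈ frontier Ω, u x = 0) {H : ℝ → ℝ} (hHc : ContDiff ℝ 1 H)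
    {ε : ℝ} (hε : 0 < ε) (hH : ∀ t, |t| ≤ ε → H t = 0) :
    ∫ x in Ω, deriv H (u x) * ‖gradient u x‖ ^ 2 = ∫ x in Ω, H (u x) * -lap u x := by
  have hu1 : ContDiff ℝ 1 u := hu.of_le (by norm_num)
  set w := Ω.indicator fun x => H (u x) with hwdef
  have hsub : tsupport w ⊆ Ω :=
    tsupport_indicator_comp_subset_self hΩ hu.continuous hbd hε hH
  have key := integral_sum_fderiv_mul_fderiv (contDiff_indicator_comp hΩ hu1 hbd hHc hε hH)
    (hasCompactSupport_indicator_comp hΩb hu.continuous hH) hu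
  rw [← hwdef, ← setIntegral_eq_integral_of_forall_compl_eq_zero (s := Ω),
    ← setIntegral_eq_integral_of_forall_compl_eq_zero (s := Ω) (f := fun x => w x * _)] at key
  · convert key using 1
    · refine setIntegral_congr_fun hΩ.measurableSet fun x hx => ?_
      simp only [hwdef, fderiv_indicator_comp hΩ hu1 hHc hx, norm_gradient_sq_eq_sum,
        Finset.mul_sum, smul_apply, smul_eq_mul]
      exact Finset.sum_congr rfl fun i _ => by ring
    · refine setIntegral_congr_fun hΩ.measurableSet fun x hx => ?_
      simp [hwdef, hx]
  · intro x hx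
    simp [hwdef, hx]
  · intro x hx
    simp [fderiv_of_notMem_tsupport ℝ fun h => hx (hsub h)]

lemma norm_gradient_indicator_comp_sq (hΩ : IsOpen Ω) (hu : ContDiff ℝ 1 u) {H : ℝ → ℝ}
    (hHc : ContDiff ℝ 1 H) {x : EuclideanSpace ℝ (Fin n)} (hx : x ∈ Ω) :
    ‖gradient (Ω.indicator fun x => H (u x)) x‖ ^ 2 = deriv H (u x) ^ 2 * ‖gradient u x‖ ^ 2 := by
  simp only [norm_gradient_sq_eq_sum, fderiv_indicator_comp hΩ hu hHc hx, Finset.mul_sum,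
    smul_apply, smul_eq_mul, mul_pow]

end Euclidean

/-- Key estimate for stable solutions of the Gelfand problem -Δu = λeᵘ:
(1 - α/2) ∫ e^{(1+2α)u} ≤ 2 ∫ e^{(1+α)u} for every 0 < α < 2. -/
theorem exponential_stable_estimate {n : ℕ}
    (Ω : Set (EuclideanSpace ℝ (Fin n))) (hΩo : IsOpen Ω)
    (hΩb : Bornology.IsBounded Ω) (lam : ℝ) (hlam : 0 < lam)
    (u : EuclideanSpace ℝ (Fin n) → ℝ) (hu : ContDiff ℝ (⊤ : ℕ∞) u)
    (heq : ∀ x ∈ Ω, -lap u x = lam * Real.exp (u x))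
    (hbd : ∀ x ∈ frontier Ω, u x = 0)
    (hstable : ∀ ξ : EuclideanSpace ℝ (Fin n) → ℝ, ContDiff ℝ 1 ξ →
      HasCompactSupport ξ → tsupport ξ ⊆ Ω →
      ∫ x in Ω, lam * Real.exp (u x) * (ξ x) ^ 2 ≤ ∫ x in Ω, ‖gradient ξ x‖ ^ 2)
    (α : ℝ) (hα0 : 0 < α) (hα2 : α < 2) :
    (1 - α / 2) * ∫ x in Ω, Real.exp ((1 + 2 * α) * u x)
      ≤ 2 * ∫ x in Ω, Real.exp ((1 + α) * u x) := by
  have hu2 : ContDiff ℝ 2 u := contDiff_infty.1 hu _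
  have hu1 : ContDiff ℝ 1 u := contDiff_infty.1 hu _
  have hfin : IsFiniteMeasure (volume.restrict Ω) := ⟨by
    simpa using hΩb.measure_lt_top⟩
  obtain ⟨M, hM⟩ := hΩb.isCompact_closure.exists_bound_of_continuousOn hu.continuous.continuousOn
  have hMae : ∀ᵐ x ∂volume.restrict Ω, |u x| ≤ M := by
    filter_upwards [ae_restrict_mem hΩo.measurableSet] with x hx using hM x (subset_closure hx)
  set g : ℝ → ℝ := fun s => α * Real.exp (α * s) with hgdef
  have hg : Continuous g := by fun_prop
  have hg2 : Continuous fun s => g s ^ 2 := hg.pow 2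
  have hintg (t : ℝ) : ∫ s in (0 : ℝ)..t, g s = Real.exp (α * t) - 1 := integral_mul_exp_mul t
  have hintg2 (t : ℝ) :
      ∫ s in (0 : ℝ)..t, g s ^ 2 = α / 2 * (Real.exp (2 * α * t) - 1) := by
    rw [← integral_mul_exp_mul t, ← intervalIntegral.integral_const_mul]
    refine intervalIntegral.integral_congr fun s _ => ?_
    have : Real.exp (2 * α * s) = Real.exp (α * s) ^ 2 := by
      rw [← Real.exp_nat_mul]; push_cast; ring_nf
    simp only [hgdef, this]
    ring
  have hε (k : ℕ) : (0 : ℝ) < 1 / (k + 1) := by positivity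
  have hvanish {m : ℕ} (hm : m ≠ 0) (f : ℝ → ℝ) (k : ℕ) (t : ℝ) (ht : |t| ≤ 1 / (k + 1)) :
      cutoffPrimitive m f (k + 1) t = 0 := by
    refine cutoffPrimitive_eq_zero hm ?_
    rw [le_div_iff₀ (by positivity)] at ht
    push_cast
    linarith
  have hineq (k : ℕ) :
      ∫ x in Ω, lam * Real.exp (u x) * cutoffPrimitive 1 g (k + 1) (u x) ^ 2 ≤
        ∫ x in Ω, lam * Real.exp (u x) * cutoffPrimitive 2 (fun s => g s ^ 2) (k + 1) (u x) := by
    have hG := contDiff_cutoffPrimitive (m := 1) hg (k + 1)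
    have hH := contDiff_cutoffPrimitive (m := 2) hg2 (k + 1)
    have h0G := hvanish one_ne_zero g k
    have hst := hstable _ (contDiff_indicator_comp hΩo hu1 hbd hG (hε k) h0G)
      (hasCompactSupport_indicator_comp hΩb hu.continuous h0G)
      (tsupport_indicator_comp_subset_self hΩo hu.continuous hbd (hε k) h0G)
    have hgr := setIntegral_deriv_mul_norm_gradient_sq hΩo hΩb hu2 hbd hH (hε k)
      (hvanish two_ne_zero _ k)
    calc _ = _ := setIntegral_congr_fun hΩo.measurableSet fun x hx => by
            simp [Set.indicator_of_mem hx]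
      _ ≤ _ := hst
      _ = _ := setIntegral_congr_fun hΩo.measurableSet fun x hx => by
            simp only [norm_gradient_indicator_comp_sq hΩo hu1 hG hx, deriv_cutoffPrimitive hg]
            rw [pow_one, mul_pow, ← deriv_cutoffPrimitive hg2]
      _ = _ := hgr
      _ = _ := setIntegral_congr_fun hΩo.measurableSet fun x hx => by
            simp only [heq x hx]
            ring
  obtain ⟨C₁, hC₁⟩ := exists_abs_cutoffPrimitive_le (m := 1) hg M
  obtain ⟨C₂, hC₂⟩ := exists_abs_cutoffPrimitive_le (m := 2) hg2 M
  have hexp {t : ℝ} (ht : |t| ≤ M) : |lam * Real.exp t| ≤ lam * Real.exp M := by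
    rw [abs_of_pos (by positivity)]
    have := (le_abs_self t).trans ht
    gcongr
  have hlim₁ := tendsto_integral_comp_of_bounded (μ := volume.restrict Ω)
    hu.continuous.aemeasurable hMae (C := lam * Real.exp M * C₁ ^ 2)
    (F := fun k t => lam * Real.exp t * cutoffPrimitive 1 g (k + 1) t ^ 2)
    (f := fun t => lam * Real.exp t * (Real.exp (α * t) - 1) ^ 2)
    (fun k => by
      have := (contDiff_cutoffPrimitive (m := 1) hg (k + 1)).continuous
      fun_prop)
    (fun k t ht => by
      rw [abs_mul, abs_pow]
      have := hexp ht
      have := hC₁ (k + 1) t ht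
      gcongr)
    (fun t => by
      rw [← hintg]
      exact (((tendsto_cutoffPrimitive hg t).comp (tendsto_add_atTop_nat 1)).pow 2).const_mul _)
  have hlim₂ := tendsto_integral_comp_of_bounded (μ := volume.restrict Ω)
    hu.continuous.aemeasurable hMae (C := lam * Real.exp M * C₂)
    (F := fun k t => lam * Real.exp t * cutoffPrimitive 2 (fun s => g s ^ 2) (k + 1) t)
    (f := fun t => lam * Real.exp t * (α / 2 * (Real.exp (2 * α * t) - 1)))
    (fun k => by
      have := (contDiff_cutoffPrimitive (m := 2) hg2 (k + 1)).continuous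
      fun_prop)
    (fun k t ht => by
      rw [abs_mul]
      have := hexp ht
      have := hC₂ (k + 1) t ht
      gcongr)
    (fun t => by
      rw [← hintg2]
      exact ((tendsto_cutoffPrimitive hg2 t).comp (tendsto_add_atTop_nat 1)).const_mul _)
  have hle := le_of_tendsto_of_tendsto' hlim₁ hlim₂ hineq
  have hint (a : ℝ) : Integrable (fun x => Real.exp (a * u x)) (volume.restrict Ω) :=
    ((continuous_const.mul hu.continuous).rexp.continuousOn.integrableOn_compact
      hΩb.isCompact_closure).mono_set subset_closure
  have h₁ : ∫ x in Ω, lam * Real.exp (u x) * (Real.exp (α * u x) - 1) ^ 2 =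
      lam * ((∫ x in Ω, Real.exp ((1 + 2 * α) * u x)) -
        2 * (∫ x in Ω, Real.exp ((1 + α) * u x)) + ∫ x in Ω, Real.exp (1 * u x)) := by
    have hsub : Integrable (fun x => Real.exp ((1 + 2 * α) * u x) -
        2 * Real.exp ((1 + α) * u x)) (volume.restrict Ω) := (hint _).sub ((hint _).const_mul 2)
    rw [← integral_const_mul, ← integral_sub (hint _) ((hint _).const_mul 2),
      ← integral_add hsub (hint _), ← integral_const_mul]
    congr 1 with x
    simp only [add_mul, Real.exp_add, one_mul, mul_assoc]
    rw [show 2 * (α * u x) = α * u x + α * u x by ring, Real.exp_add]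
    ring
  have h₂ : ∫ x in Ω, lam * Real.exp (u x) * (α / 2 * (Real.exp (2 * α * u x) - 1)) =
      lam * (α / 2 * ((∫ x in Ω, Real.exp ((1 + 2 * α) * u x)) -
        ∫ x in Ω, Real.exp (1 * u x))) := by
    rw [← integral_sub (hint _) (hint _), ← integral_const_mul, ← integral_const_mul]
    congr 1 with x
    simp only [add_mul, Real.exp_add, one_mul]
    ring
  rw [h₁, h₂] at hle
  have hle' := le_of_mul_le_mul_left hle hlam
  have hpos : 0 ≤ ∫ x in Ω, Real.exp (1 * u x) := integral_nonneg fun x => (Real.exp_pos _).le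
  nlinarith [mul_nonneg hα0.le hpos]
end

section
/- Let Ω ⊂ ℝⁿ be a bounded domain, u a smooth solution of -Δu = f(u) in Ω that is stable (∫_Ω f'(u)ξ² ≤ ∫_Ω |∇ξ|² for all ξ ∈ C¹_c(Ω)), and let c be a smooth function on Ω. Then for every Lipschitz function η with compact support in Ω: ∫_Ω (Δc + f'(u)c) c η² dx ≤ ∫_Ω c² |∇η|² dx. -/
open MeasureTheory

open Filter Topology Convolution

theorem norm_sq_eq_sum_sq_apply_single {n : ℕ} (L : EuclideanSpace ℝ (Fin n) →L[ℝ] ℝ) :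
    ‖L‖ ^ 2 = ∑ i, L (EuclideanSpace.single i (1 : ℝ)) ^ 2 := by
  rw [← (InnerProductSpace.toDual ℝ (EuclideanSpace ℝ (Fin n))).symm.norm_map L,
    EuclideanSpace.norm_sq_eq]
  refine Finset.sum_congr rfl fun i _ => ?_
  rw [Real.norm_eq_abs, sq_abs]
  congr 1
  rw [← InnerProductSpace.toDual_symm_apply (x := EuclideanSpace.single i (1 : ℝ)) (y := L),
    EuclideanSpace.inner_single_right]
  simp

section Mollification

variable {E : Type*} [NormedAddCommGroup E] [NormedSpace ℝ E] [FiniteDimensional ℝ E]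
  [MeasurableSpace E] [BorelSpace E] {μ : Measure E} [μ.IsAddHaarMeasure]

theorem ContDiffBump.abs_normed_convolution_le (φ : ContDiffBump (0 : E)) {g : E → ℝ} {C : ℝ}
    (hg : ∀ x, |g x| ≤ C) (x : E) :
    |(φ.normed μ ⋆[ContinuousLinearMap.lsmul ℝ ℝ, μ] g : E → ℝ) x| ≤ C := by
  rw [convolution_def, ← Real.norm_eq_abs]
  refine LE.le.trans_eq (b := ∫ t, φ.normed μ t * C ∂μ) (norm_integral_le_of_norm_le
    (φ.integrable_normed.mul_const C) (Eventually.of_forall fun t => ?_)) ?_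
  · rw [ContinuousLinearMap.lsmul_apply, norm_smul, Real.norm_of_nonneg (φ.nonneg_normed t)]
    exact mul_le_mul_of_nonneg_left (hg _) (φ.nonneg_normed t)
  · rw [integral_mul_const, φ.integral_normed, one_mul]

theorem ContDiffBump.tsupport_normed_convolution_subset (φ : ContDiffBump (0 : E)) (g : E → ℝ) :
    tsupport (φ.normed μ ⋆[ContinuousLinearMap.lsmul ℝ ℝ, μ] g : E → ℝ) ⊆
      Metric.cthickening φ.rOut (tsupport g) := by
  refine closure_minimal (fun x hx => ?_) Metric.isClosed_cthickening
  obtain ⟨a, ha, b, hb, rfl⟩ :=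
    support_convolution_subset_swap (ContinuousLinearMap.lsmul ℝ ℝ : ℝ →L[ℝ] ℝ →L[ℝ] ℝ) hx
  rw [φ.support_normed_eq, mem_ball_zero_iff] at hb
  refine Metric.mem_cthickening_of_dist_le _ a _ _ (subset_tsupport g ha) ?_
  simpa using hb.le

theorem ContDiffBump.fderiv_normed_convolution_apply (φ : ContDiffBump (0 : E)) {g : E → ℝ}
    {K : NNReal} (hg : LipschitzWith K g) (x v : E) :
    fderiv ℝ (φ.normed μ ⋆[ContinuousLinearMap.lsmul ℝ ℝ, μ] g : E → ℝ) x v =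
      (φ.normed μ ⋆[ContinuousLinearMap.lsmul ℝ ℝ, μ] fun y => lineDeriv ℝ g y v : E → ℝ) x := by
  have hφ : ContDiff ℝ 1 (φ.normed μ) := φ.contDiff_normed
  have hgl : LocallyIntegrable g μ := hg.continuous.locallyIntegrable
  have hd := φ.hasCompactSupport_normed.hasFDerivAt_convolution_right (μ := μ)
    (ContinuousLinearMap.lsmul ℝ ℝ : ℝ →L[ℝ] ℝ →L[ℝ] ℝ).flip hgl hφ x
  rw [convolution_flip] at hd
  rw [hd.fderiv, convolution_precompR_apply _ hgl (φ.hasCompactSupport_normed.fderiv ℝ)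
    (hφ.continuous_fderiv one_ne_zero), convolution_def, convolution_eq_swap]
  have hcomp : ContDiff ℝ 1 fun y => φ.normed μ (x - y) := by fun_prop
  have hcs : HasCompactSupport fun y => φ.normed μ (x - y) :=
    φ.hasCompactSupport_normed.comp_homeomorph (Homeomorph.subLeft x)
  obtain ⟨D, hD⟩ := ContDiff.lipschitzWith_of_hasCompactSupport hcs hcomp one_ne_zero
  have h := hg.integral_lineDeriv_mul_eq (μ := μ) hD hcs v
  have hline (y : E) : lineDeriv ℝ (fun y => φ.normed μ (x - y)) y (-v) =
      fderiv ℝ (φ.normed μ) (x - y) v := by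
    rw [(hcomp.differentiable one_ne_zero y).lineDeriv_eq_fderiv]
    have := ((hφ.differentiable one_ne_zero (x - y)).hasFDerivAt.comp y
      ((hasFDerivAt_id y).const_sub x)).fderiv
    simp only [Function.comp_def] at this
    simp [this]
  simp only [hline] at h
  simp only [ContinuousLinearMap.lsmul_apply, ContinuousLinearMap.flip_apply, smul_eq_mul]
  rw [← h]
  simp only [mul_comm]

/-- A compactly supported Lipschitz function is a limit of compactly supported `C¹` functions,
with uniform bounds and almost everywhere convergence of directional derivatives. -/
theorem LipschitzWith.exists_seq_contDiff_tendsto {g : E → ℝ} {K : NNReal}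
    (hg : LipschitzWith K g) (hgc : HasCompactSupport g) {Ω : Set E} (hΩ : IsOpen Ω)
    (hgΩ : tsupport g ⊆ Ω) {M : ℝ} (hM : ∀ x, |g x| ≤ M) :
    ∃ ψ : ℕ → E → ℝ, (∀ k, ContDiff ℝ 1 (ψ k)) ∧ (∀ k, HasCompactSupport (ψ k)) ∧
      (∀ k, tsupport (ψ k) ⊆ Ω) ∧ (∀ k x, |ψ k x| ≤ M) ∧ (∀ k x, ‖fderiv ℝ (ψ k) x‖ ≤ K) ∧
      (∀ x, Tendsto (fun k => ψ k x) atTop (𝓝 (g x))) ∧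
      ∀ v, ∀ᵐ x ∂μ, Tendsto (fun k => fderiv ℝ (ψ k) x v) atTop (𝓝 (fderiv ℝ g x v)) := by
  obtain ⟨δ, hδ, hδΩ⟩ := hgc.isCompact.exists_cthickening_subset_open hΩ hgΩ
  let r : ℕ → ℝ := fun k => δ / ((k : ℝ) + 1)
  have hr (k : ℕ) : 0 < r k := by positivity
  have hrδ (k : ℕ) : r k ≤ δ := div_le_self hδ.le (by simp)
  let φ : ℕ → ContDiffBump (0 : E) := fun k => ⟨r k / 2, r k, half_pos (hr k), half_lt_self (hr k)⟩
  have hφ : Tendsto (fun k => (φ k).rOut) atTop (𝓝 0) := by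
    simpa [φ, r, div_eq_mul_one_div δ] using
      (tendsto_one_div_add_atTop_nhds_zero_nat (𝕜 := ℝ)).const_mul δ
  have hsupp (k : ℕ) := ((φ k).tsupport_normed_convolution_subset (μ := μ) g).trans
    (Metric.cthickening_mono (hrδ k) _)
  have hlip (x v : E) : |lineDeriv ℝ g x v| ≤ K * ‖v‖ := norm_lineDeriv_le_of_lipschitz ℝ hg
  refine ⟨fun k => (φ k).normed μ ⋆[ContinuousLinearMap.lsmul ℝ ℝ, μ] g, fun k => ?_, fun k => ?_,
    fun k => (hsupp k).trans hδΩ, fun k => (φ k).abs_normed_convolution_le hM, fun k x => ?_,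
    ContDiffBump.convolution_tendsto_right_of_continuous hφ hg.continuous, fun v => ?_⟩
  · exact (φ k).hasCompactSupport_normed.contDiff_convolution_left _ (φ k).contDiff_normed
      hg.continuous.locallyIntegrable
  · exact hgc.isCompact.cthickening.of_isClosed_subset (isClosed_tsupport _) (hsupp k)
  · refine ContinuousLinearMap.opNorm_le_bound _ K.2 fun v => ?_
    rw [(φ k).fderiv_normed_convolution_apply hg]
    exact (φ k).abs_normed_convolution_le (hlip · v) x
  · have hloc : LocallyIntegrable (fun x => lineDeriv ℝ g x v) μ :=
      (locallyIntegrable_const (K * ‖v‖ : ℝ)).mono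
        (measurable_lineDeriv hg.continuous).aestronglyMeasurable
        (Eventually.of_forall fun x => (hlip x v).trans (le_abs_self _))
    filter_upwards [hg.ae_differentiableAt (μ := μ),
      ContDiffBump.ae_convolution_tendsto_right_of_locallyIntegrable (K := 2) hφ
        (Eventually.of_forall fun k => by simp [φ]; linarith) hloc] with x hx hlim
    simpa only [(φ _).fderiv_normed_convolution_apply hg, hx.lineDeriv_eq_fderiv] using hlim

end Mollification

theorem HasCompactSupport.sq {α : Type*} [TopologicalSpace α] {g : α → ℝ}
    (hg : HasCompactSupport g) : HasCompactSupport fun x => g x ^ 2 :=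
  hg.comp_left (g := fun t : ℝ => t ^ 2) (by simp)

section IntegrationByParts

variable {n : ℕ} {Ω : Set (EuclideanSpace ℝ (Fin n))} {c ψ : EuclideanSpace ℝ (Fin n) → ℝ}

theorem continuous_lap (hc : ContDiff ℝ 2 c) : Continuous (lap c) := by
  refine continuous_finsetSum _ fun i _ => ?_
  have h : ContDiff ℝ 1 fun y => fderiv ℝ c y (EuclideanSpace.single i (1 : ℝ)) :=
    (hc.fderiv_right (m := 1) le_rfl).clm_apply contDiff_const
  exact (h.continuous_fderiv one_ne_zero).clm_apply continuous_const

theorem norm_fderiv_mul_sq_add_lap_mul (hc : Differentiable ℝ c) (hψ : Differentiable ℝ ψ)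
    (x : EuclideanSpace ℝ (Fin n)) :
    ‖fderiv ℝ (fun y => c y * ψ y) x‖ ^ 2 + lap c x * c x * ψ x ^ 2 =
      c x ^ 2 * ‖fderiv ℝ ψ x‖ ^ 2 +
        ∑ i, (fderiv ℝ (fun y => c y * ψ y ^ 2) x (EuclideanSpace.single i 1) *
            fderiv ℝ c x (EuclideanSpace.single i 1) +
          c x * ψ x ^ 2 * fderiv ℝ (fun y => fderiv ℝ c y (EuclideanSpace.single i 1)) x
            (EuclideanSpace.single i 1)) := by
  rw [norm_sq_eq_sum_sq_apply_single, norm_sq_eq_sum_sq_apply_single, lap, Finset.sum_mul,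
    Finset.sum_mul, Finset.mul_sum, ← Finset.sum_add_distrib, ← Finset.sum_add_distrib]
  refine Finset.sum_congr rfl fun i _ => ?_
  rw [fderiv_fun_mul (hc x) (hψ x), fderiv_fun_mul (hc x) ((hψ x).fun_pow 2),
    fderiv_fun_pow 2 (hψ x)]
  simp
  ring

theorem setIntegral_norm_fderiv_mul_sq_add (hc : ContDiff ℝ 2 c) (hψ : ContDiff ℝ 1 ψ)
    (hψc : HasCompactSupport ψ) (hψΩ : tsupport ψ ⊆ Ω) :
    (∫ x in Ω, ‖fderiv ℝ (fun y => c y * ψ y) x‖ ^ 2) + ∫ x in Ω, lap c x * c x * ψ x ^ 2 =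
      ∫ x in Ω, c x ^ 2 * ‖fderiv ℝ ψ x‖ ^ 2 := by
  have hc1 : ContDiff ℝ 1 c := hc.of_le one_le_two
  have hcψ : ContDiff ℝ 1 fun y => c y * ψ y := hc1.mul hψ
  have hcψ2 : ContDiff ℝ 1 fun y => c y * ψ y ^ 2 := hc1.mul (hψ.pow 2)
  have hψ2c : HasCompactSupport fun y => ψ y ^ 2 := hψc.sq
  have hcψc : HasCompactSupport fun y => c y * ψ y := hψc.mul_left
  have hcψ2c : HasCompactSupport fun y => c y * ψ y ^ 2 := hψ2c.mul_left
  have hψ0 : ∀ x ∉ Ω, ψ x = 0 := fun x hx => image_eq_zero_of_notMem_tsupport fun h => hx (hψΩ h)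
  have hDψ0 : ∀ x ∉ Ω, fderiv ℝ ψ x = 0 := fun x hx =>
    fderiv_of_notMem_tsupport ℝ fun h => hx (hψΩ h)
  have hDcψ0 : ∀ x ∉ Ω, fderiv ℝ (fun y => c y * ψ y) x = 0 := fun x hx =>
    fderiv_of_notMem_tsupport ℝ fun h => hx (hψΩ (tsupport_mul_subset_right h))
  rw [setIntegral_eq_integral_of_forall_compl_eq_zero fun x hx => by simp [hDcψ0 x hx],
    setIntegral_eq_integral_of_forall_compl_eq_zero fun x hx => by simp [hψ0 x hx],
    setIntegral_eq_integral_of_forall_compl_eq_zero fun x hx => by simp [hDψ0 x hx]]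
  have hdir (i : Fin n) :
      ContDiff ℝ 1 fun y => fderiv ℝ c y (EuclideanSpace.single i (1 : ℝ)) :=
    (hc.fderiv_right (m := 1) le_rfl).clm_apply contDiff_const
  have hA (i : Fin n) : Integrable fun x =>
      fderiv ℝ (fun y => c y * ψ y ^ 2) x (EuclideanSpace.single i 1) *
        fderiv ℝ c x (EuclideanSpace.single i 1) :=
    (((hcψ2.continuous_fderiv one_ne_zero).clm_apply continuous_const).mul
      (hdir i).continuous).integrable_of_hasCompactSupport
        (hcψ2c.fderiv_apply ℝ _).mul_right
  have hB (i : Fin n) : Integrable fun x => c x * ψ x ^ 2 *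
      fderiv ℝ (fun y => fderiv ℝ c y (EuclideanSpace.single i 1)) x
        (EuclideanSpace.single i 1) :=
    (hcψ2.continuous.mul (((hdir i).continuous_fderiv one_ne_zero).clm_apply
      continuous_const)).integrable_of_hasCompactSupport hcψ2c.mul_right
  have hC (i : Fin n) : Integrable fun x => c x * ψ x ^ 2 *
      fderiv ℝ c x (EuclideanSpace.single i 1) :=
    (hcψ2.continuous.mul (hdir i).continuous).integrable_of_hasCompactSupport hcψ2c.mul_right
  have hAB (i : Fin n) := (hA i).add (hB i)
  simp only [Pi.add_def] at hAB
  have hzero : ∫ x, ∑ i, (fderiv ℝ (fun y => c y * ψ y ^ 2) x (EuclideanSpace.single i 1) *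
        fderiv ℝ c x (EuclideanSpace.single i 1) + c x * ψ x ^ 2 *
      fderiv ℝ (fun y => fderiv ℝ c y (EuclideanSpace.single i 1)) x
        (EuclideanSpace.single i 1)) = 0 := by
    rw [integral_finsetSum _ fun i _ => hAB i]
    refine Finset.sum_eq_zero fun i _ => ?_
    rw [integral_add (hA i) (hB i), integral_mul_fderiv_eq_neg_fderiv_mul_of_integrable (hA i)
      (hB i) (hC i) (fun x _ => hcψ2.differentiable one_ne_zero x)
      (fun x _ => (hdir i).differentiable one_ne_zero x), add_neg_cancel]
  rw [← integral_add, integral_congr_ae (Eventually.of_forall <| norm_fderiv_mul_sq_add_lap_mul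
    (hc1.differentiable one_ne_zero) (hψ.differentiable one_ne_zero)), integral_add, hzero,
    add_zero]
  · exact ((hc.continuous.pow 2).mul
      ((hψ.continuous_fderiv one_ne_zero).norm.pow 2)).integrable_of_hasCompactSupport
        (hψc.fderiv ℝ |>.norm.sq).mul_left
  · exact integrable_finsetSum _ fun i _ => hAB i
  · exact ((hcψ.continuous_fderiv one_ne_zero).norm.pow 2).integrable_of_hasCompactSupport
      (hcψc.fderiv ℝ |>.norm.sq)
  · exact (((continuous_lap hc).mul hc.continuous).mul
      (hψ.continuous.pow 2)).integrable_of_hasCompactSupport hψ2c.mul_left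

/-- The stability inequality tested with `c * ψ` for a `C¹` function `ψ`. -/
theorem setIntegral_lap_add_mul_le_of_contDiff {V : EuclideanSpace ℝ (Fin n) → ℝ}
    (hV : Continuous V)
    (hstable : ∀ ξ : EuclideanSpace ℝ (Fin n) → ℝ, ContDiff ℝ 1 ξ →
      HasCompactSupport ξ → tsupport ξ ⊆ Ω →
      ∫ x in Ω, V x * (ξ x) ^ 2 ≤ ∫ x in Ω, ‖gradient ξ x‖ ^ 2)
    (hc : ContDiff ℝ 2 c) (hψ : ContDiff ℝ 1 ψ)
    (hψc : HasCompactSupport ψ) (hψΩ : tsupport ψ ⊆ Ω) :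
    ∫ x in Ω, (lap c x + V x * c x) * c x * ψ x ^ 2 ≤
      ∫ x in Ω, c x ^ 2 * ‖fderiv ℝ ψ x‖ ^ 2 := by
  have h := hstable (fun y => c y * ψ y) ((hc.of_le one_le_two).mul hψ) hψc.mul_left
    (tsupport_mul_subset_right.trans hψΩ)
  simp only [gradient, LinearIsometryEquiv.norm_map] at h
  have hψ2c : HasCompactSupport fun y => ψ y ^ 2 := hψc.sq
  have hlap : Integrable fun x => lap c x * c x * ψ x ^ 2 :=
    (((continuous_lap hc).mul hc.continuous).mul
      (hψ.continuous.pow 2)).integrable_of_hasCompactSupport hψ2c.mul_left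
  have hVint : Integrable fun x => V x * (c x * ψ x) ^ 2 :=
    (hV.mul ((hc.continuous.mul hψ.continuous).pow 2)).integrable_of_hasCompactSupport
      (hψc.mul_left (f := c)).sq.mul_left
  rw [← setIntegral_norm_fderiv_mul_sq_add hc hψ hψc hψΩ]
  calc ∫ x in Ω, (lap c x + V x * c x) * c x * ψ x ^ 2
      = (∫ x in Ω, V x * (c x * ψ x) ^ 2) + ∫ x in Ω, lap c x * c x * ψ x ^ 2 := by
        rw [← integral_add hVint.integrableOn hlap.integrableOn]
        congr 1 with x
        ring
    _ ≤ _ := by gcongr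

end IntegrationByParts

theorem Continuous.exists_abs_le_of_isBounded {E : Type*} [PseudoMetricSpace E] [ProperSpace E]
    {g : E → ℝ} (hg : Continuous g) {s : Set E} (hs : Bornology.IsBounded s) :
    ∃ C, ∀ x ∈ s, |g x| ≤ C := by
  obtain ⟨C, hC⟩ := hs.isCompact_closure.exists_bound_of_continuousOn hg.continuousOn
  exact ⟨C, fun x hx => hC x (subset_closure hx)⟩

/-- Testing the stability inequality with ξ = cη and integrating by parts:
∫ (Δc + f'(u)c) c η² ≤ ∫ c² |∇η|². -/
theorem stability_with_product_test {n : ℕ}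
    (Ω : Set (EuclideanSpace ℝ (Fin n))) (hΩo : IsOpen Ω)
    (hΩb : Bornology.IsBounded Ω)
    (f : ℝ → ℝ) (hf : ContDiff ℝ 1 f)
    (u : EuclideanSpace ℝ (Fin n) → ℝ) (hu : ContDiff ℝ (⊤ : ℕ∞) u)
    (heq : ∀ x ∈ Ω, -lap u x = f (u x))
    (hstable : ∀ ξ : EuclideanSpace ℝ (Fin n) → ℝ, ContDiff ℝ 1 ξ →
      HasCompactSupport ξ → tsupport ξ ⊆ Ω →
      ∫ x in Ω, deriv f (u x) * (ξ x) ^ 2 ≤ ∫ x in Ω, ‖gradient ξ x‖ ^ 2)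
    (c : EuclideanSpace ℝ (Fin n) → ℝ) (hc : ContDiff ℝ (⊤ : ℕ∞) c)
    (η : EuclideanSpace ℝ (Fin n) → ℝ) (K : NNReal) (hη : LipschitzWith K η)
    (hηcs : HasCompactSupport η) (hηsupp : tsupport η ⊆ Ω) :
    ∫ x in Ω, (lap c x + deriv f (u x) * c x) * c x * (η x) ^ 2
      ≤ ∫ x in Ω, (c x) ^ 2 * ‖fderiv ℝ η x‖ ^ 2 := by
  have hc2 : ContDiff ℝ 2 c := hc.of_le (WithTop.coe_le_coe.2 le_top)
  have hV : Continuous fun x => deriv f (u x) := (hf.continuous_deriv le_rfl).comp hu.continuous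
  obtain ⟨M, hM⟩ := hηcs.exists_bound_of_continuous hη.continuous
  obtain ⟨ψ, hψ, hψc, hψΩ, hψM, hψK, hψlim, hDψlim⟩ :=
    hη.exists_seq_contDiff_tendsto (μ := volume) hηcs hΩo hηsupp hM
  have hfin : IsFiniteMeasure (volume.restrict Ω) :=
    isFiniteMeasure_restrict.2 hΩb.measure_lt_top.ne
  have hcoef : Continuous fun x => (lap c x + deriv f (u x) * c x) * c x :=
    ((continuous_lap hc2).add (hV.mul hc.continuous)).mul hc.continuous
  obtain ⟨A, hA⟩ := hcoef.exists_abs_le_of_isBounded hΩb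
  obtain ⟨B, hB⟩ :=
    (show Continuous fun x => c x ^ 2 from hc.continuous.pow 2).exists_abs_le_of_isBounded hΩb
  have hDae : ∀ᵐ x, Tendsto (fun k => ‖fderiv ℝ (ψ k) x‖ ^ 2) atTop (𝓝 (‖fderiv ℝ η x‖ ^ 2)) := by
    filter_upwards [ae_all_iff.2 fun i => hDψlim (EuclideanSpace.single i 1)] with x hx
    simp only [norm_sq_eq_sum_sq_apply_single]
    exact tendsto_finsetSum _ fun i _ => (hx i).pow 2
  refine le_of_tendsto_of_tendsto' (b := atTop) (f := fun k : ℕ =>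
      ∫ x in Ω, (lap c x + deriv f (u x) * c x) * c x * ψ k x ^ 2)
    (g := fun k : ℕ => ∫ x in Ω, c x ^ 2 * ‖fderiv ℝ (ψ k) x‖ ^ 2) ?_ ?_ fun k =>
      setIntegral_lap_add_mul_le_of_contDiff hV hstable hc2 (hψ k) (hψc k) (hψΩ k)
  · refine tendsto_integral_of_dominated_convergence (fun _ => A * M ^ 2)
      (fun k => (hcoef.mul ((hψ k).continuous.pow 2)).aestronglyMeasurable)
      (integrable_const _) (fun k => ?_)
      (Eventually.of_forall fun x => ((hψlim x).pow 2).const_mul _)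
    filter_upwards [ae_restrict_mem hΩo.measurableSet] with x hx
    rw [norm_mul, norm_pow, Real.norm_eq_abs, Real.norm_eq_abs]
    gcongr
    · exact (abs_nonneg _).trans (hA x hx)
    · exact hA x hx
    · exact hψM k x
  · refine tendsto_integral_of_dominated_convergence (fun _ => B * (K : ℝ) ^ 2)
      (fun k => ((hc.continuous.pow 2).mul
        (((hψ k).continuous_fderiv one_ne_zero).norm.pow 2)).aestronglyMeasurable)
      (integrable_const _) (fun k => ?_) ?_
    · filter_upwards [ae_restrict_mem hΩo.measurableSet] with x hx
      rw [norm_mul, norm_pow (‖fderiv ℝ (ψ k) x‖), norm_norm]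
      gcongr
      · exact (abs_nonneg _).trans (hB x hx)
      · exact hB x hx
      · exact hψK k x
    · filter_upwards [ae_restrict_of_ae hDae] with x hx using hx.const_mul _
end

section
/- Let n ≥ 2 and let u be a smooth radial function on B₁ ⊂ ℝⁿ satisfying, for every Lipschitz η on [0,1] vanishing at r=1 (viewed as radial test function), the inequality (n-1)∫_{B₁} u_r² (η²/r²) dx ≤ ∫_{B₁} u_r² |∇η|² dx. Suppose 1 ≤ α < 1 + √(n-1). Then there is a constant C(α,n) such that ∫_{B_{1/2}} u_r² r^{-2α} dx ≤ C(α,n) ∫_{B_{1/2} \ B_{1/4}} u_r² dx. -/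
open MeasureTheory

/-- The radial test function equal to `r * ε ^ (-α)` for `r ≤ ε`, to `r ^ (1 - α)` on
`[ε, 1/4]`, affine on `[1/4, 1/2]`, and zero beyond `1/2`. -/
noncomputable def truncatedPower (α ε r : ℝ) : ℝ :=
  (max ε (min r (1 / 4))) ^ (1 - α) + ε ^ (-α) * (min r ε - ε)
    - 4 ^ α * (max (1 / 4) (min r (1 / 2)) - 1 / 4)

namespace truncatedPower

variable {α ε r : ℝ}

lemma lipschitz (hε : 0 < ε) : ∃ K : NNReal, LipschitzWith K (truncatedPower α ε) := by
  have hφ : ContDiffOn ℝ 1 (fun t : ℝ => t ^ (1 - α)) (Set.Icc ε (max ε (1 / 4))) :=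
    contDiffOn_id.rpow_const_of_ne fun t ht => (hε.trans_le ht.1).ne'
  obtain ⟨K, hK⟩ := hφ.exists_lipschitzOnWith one_ne_zero (convex_Icc _ _) isCompact_Icc
  have hclamp : LipschitzWith 1 fun r : ℝ => max ε (min r (1 / 4)) :=
    (LipschitzWith.id.min_const _).const_max _
  have h₁ : LipschitzWith (K * 1) fun r : ℝ => (max ε (min r (1 / 4))) ^ (1 - α) := by
    have := hK.comp (f := fun r : ℝ => max ε (min r (1 / 4))) (s := Set.univ)
      hclamp.lipschitzOnWith
      fun r _ => ⟨le_max_left _ _, max_le_max le_rfl (min_le_right _ _)⟩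
    exact lipschitzOnWith_univ.1 this
  have h₂ : LipschitzWith (‖ε ^ (-α)‖₊ * (1 + 0)) fun r : ℝ => ε ^ (-α) * (min r ε - ε) :=
    (lipschitzWith_smul (ε ^ (-α))).comp
      ((LipschitzWith.id.min_const ε).sub (LipschitzWith.const ε))
  have h₃ : LipschitzWith (‖(4 : ℝ) ^ α‖₊ * (1 + 0))
      fun r : ℝ => (4 : ℝ) ^ α * (max (1 / 4) (min r (1 / 2)) - 1 / 4) :=
    (lipschitzWith_smul ((4 : ℝ) ^ α)).comp
      (((LipschitzWith.id.min_const (1 / 2)).const_max (1 / 4)).sub (LipschitzWith.const _))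
  exact ⟨_, (h₁.add h₂).sub h₃⟩

lemma of_le_eps (hε : 0 < ε) (hε' : ε < 1 / 4) (hr : r ≤ ε) :
    truncatedPower α ε r = ε ^ (-α) * r := by
  rw [truncatedPower, min_eq_left (by linarith : r ≤ 1 / 4), max_eq_left hr, min_eq_left hr,
    min_eq_left (by linarith : r ≤ 1 / 2), max_eq_left (by linarith : r ≤ 1 / 4),
    show 1 - α = -α + 1 by ring, Real.rpow_add_one hε.ne']
  ring

lemma of_mem_Icc (hr : r ∈ Set.Icc ε (1 / 4)) :
    truncatedPower α ε r = r ^ (1 - α) := by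
  rw [truncatedPower, min_eq_left hr.2, max_eq_right hr.1, min_eq_right hr.1,
    min_eq_left (by linarith [hr.2] : r ≤ 1 / 2), max_eq_left hr.2]
  ring

lemma quarter_rpow : ((1 : ℝ) / 4) ^ (1 - α) = 4 ^ α / 4 := by
  rw [one_div, Real.inv_rpow (by norm_num), ← Real.rpow_neg (by norm_num), neg_sub,
    Real.rpow_sub_one (by norm_num)]

lemma of_mem_Icc_half (hε' : ε < 1 / 4) (hr : r ∈ Set.Icc (1 / 4) (1 / 2)) :
    truncatedPower α ε r = 4 ^ α * (1 / 2 - r) := by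
  rw [truncatedPower, min_eq_right hr.1, max_eq_right hε'.le,
    min_eq_right (by linarith [hr.1] : ε ≤ r), min_eq_left hr.2, max_eq_right hr.1, quarter_rpow]
  ring

lemma of_half_le (hε' : ε < 1 / 4) (hr : 1 / 2 ≤ r) : truncatedPower α ε r = 0 := by
  rw [truncatedPower, min_eq_right (by linarith : 1 / 4 ≤ r), max_eq_right hε'.le,
    min_eq_right (by linarith : ε ≤ r), min_eq_right hr,
    max_eq_right (by norm_num : (1 : ℝ) / 4 ≤ 1 / 2), quarter_rpow]
  ring

lemma deriv_of_lt_eps (hε : 0 < ε) (hε' : ε < 1 / 4) (hr : r < ε) :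
    deriv (truncatedPower α ε) r = ε ^ (-α) := by
  have h : truncatedPower α ε =ᶠ[nhds r] fun t => ε ^ (-α) * t := by
    filter_upwards [Iio_mem_nhds hr] with t ht using of_le_eps hε hε' (le_of_lt ht)
  rw [h.deriv_eq]
  simp

lemma deriv_of_mem_Ioo (hr : r ∈ Set.Ioo ε (1 / 4)) :
    deriv (truncatedPower α ε) r = (1 - α) * r ^ (-α) := by
  have h : truncatedPower α ε =ᶠ[nhds r] fun t => t ^ (1 - α) := by
    filter_upwards [Ioo_mem_nhds hr.1 hr.2] with t ht using of_mem_Icc ⟨ht.1.le, ht.2.le⟩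
  rw [h.deriv_eq, Real.deriv_rpow_const, show 1 - α - 1 = -α by ring]

lemma deriv_of_mem_Ioo_half (hε' : ε < 1 / 4) (hr : r ∈ Set.Ioo (1 / 4) (1 / 2)) :
    deriv (truncatedPower α ε) r = -4 ^ α := by
  have h : truncatedPower α ε =ᶠ[nhds r] fun t => 4 ^ α * (1 / 2 - t) := by
    filter_upwards [Ioo_mem_nhds hr.1 hr.2] with t ht
      using of_mem_Icc_half hε' ⟨ht.1.le, ht.2.le⟩
  rw [h.deriv_eq]
  simp

lemma deriv_of_half_lt (hε' : ε < 1 / 4) (hr : 1 / 2 < r) :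
    deriv (truncatedPower α ε) r = 0 := by
  have h : truncatedPower α ε =ᶠ[nhds r] fun _ => 0 := by
    filter_upwards [Ioi_mem_nhds hr] with t ht using of_half_le hε' (le_of_lt ht)
  rw [h.deriv_eq, deriv_const]

/-- The pointwise inequality behind the weighted estimate: away from the kinks of the test
function, the difference of the two stability integrands dominates `r ^ (-2 * α)` up to an error
supported in `[1/4, 1/2)`. -/
lemma pointwise_bound {m δ : ℝ} (hm : 1 ≤ m) (hδ : 0 ≤ δ) (hδm : δ = m - (α - 1) ^ 2)
    (hα : 0 ≤ α) (hε : 0 < ε) (hε' : ε < 1 / 4) (hr : 0 < r) (h₁ : r ≠ ε) (h₂ : r ≠ 1 / 4)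
    (h₃ : r ≠ 1 / 2) :
    (if ε ≤ r ∧ r < 1 / 2 then δ * r ^ (-2 * α) else 0)
        - (if 1 / 4 ≤ r ∧ r < 1 / 2 then (1 + δ) * (4 ^ α) ^ 2 else 0)
      ≤ m * (truncatedPower α ε r ^ 2 / r ^ 2) - deriv (truncatedPower α ε) r ^ 2 := by
  have hsq : r ^ (-2 * α) = (r ^ (-α)) ^ 2 := by
    rw [← Real.rpow_natCast, ← Real.rpow_mul hr.le]; congr 1; push_cast; ring
  rcases lt_or_gt_of_ne h₁ with h | h
  · rw [if_neg (by intro hh; linarith [hh.1]), if_neg (by intro hh; linarith [hh.1]),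
      of_le_eps hε hε' h.le, deriv_of_lt_eps hε hε' h, mul_pow,
      mul_div_cancel_right₀ _ (pow_pos hr 2).ne']
    nlinarith [sq_nonneg (ε ^ (-α))]
  rcases lt_or_gt_of_ne h₂ with h' | h'
  · rw [if_pos ⟨h.le, by linarith⟩, if_neg (by intro hh; linarith [hh.1]),
      of_mem_Icc ⟨h.le, h'.le⟩, deriv_of_mem_Ioo ⟨h, h'⟩, hsq, hδm,
      show 1 - α = -α + 1 by ring, Real.rpow_add_one hr.ne', mul_pow,
      mul_div_cancel_right₀ _ (pow_pos hr 2).ne']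
    apply le_of_eq
    ring
  rcases lt_or_gt_of_ne h₃ with h'' | h''
  · rw [if_pos ⟨h.le, h''⟩, if_pos ⟨h'.le, h''⟩, deriv_of_mem_Ioo_half hε' ⟨h', h''⟩, hsq]
    have hle : r ^ (-α) ≤ 4 ^ α := by
      rw [Real.rpow_neg hr.le, ← Real.inv_rpow hr.le]
      refine Real.rpow_le_rpow (inv_nonneg.2 hr.le) ?_ hα
      rw [inv_le_comm₀ hr (by norm_num)]
      linarith
    have hle2 : (r ^ (-α)) ^ 2 ≤ ((4 : ℝ) ^ α) ^ 2 :=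
      pow_le_pow_left₀ (Real.rpow_nonneg hr.le _) hle 2
    have hpos : 0 ≤ m * (truncatedPower α ε r ^ 2 / r ^ 2) := by positivity
    nlinarith [mul_le_mul_of_nonneg_left hle2 hδ]
  · rw [if_neg (by intro hh; linarith [hh.2]), if_neg (by intro hh; linarith [hh.2]),
      of_half_le hε' h''.le, deriv_of_half_lt hε' h'']
    simp

end truncatedPower

lemma ae_norm_ne {E : Type*} [NormedAddCommGroup E] [NormedSpace ℝ E] [MeasurableSpace E]
    [BorelSpace E] [FiniteDimensional ℝ E] [Nontrivial E] (μ : Measure E) [μ.IsAddHaarMeasure]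
    (c : ℝ) : ∀ᵐ x ∂μ, ‖x‖ ≠ c := by
  have h := Measure.addHaar_sphere μ (0 : E) c
  rw [ae_iff]
  convert h using 2
  ext x
  simp

/-- The weighted estimate away from the origin, with a constant independent of the inner
radius. -/
lemma radial_weighted_estimate_annulus {E : Type*} [NormedAddCommGroup E] [NormedSpace ℝ E]
    [MeasurableSpace E] [BorelSpace E] [FiniteDimensional ℝ E] [Nontrivial E] (μ : Measure E)
    [μ.IsAddHaarMeasure] {m α δ ε : ℝ} (hm : 1 ≤ m) (hδ : 0 ≤ δ) (hδm : δ = m - (α - 1) ^ 2)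
    (hα : 0 ≤ α) (hε : 0 < ε) (hε' : ε < 1 / 4) {g : E → ℝ} (hg : Continuous g)
    (hg0 : ∀ x, 0 ≤ g x)
    (hint : IntegrableOn (fun x => g x * ‖x‖ ^ (-2 * α)) (Metric.ball 0 (1 / 2)) μ)
    (hstab : m * ∫ x in Metric.ball (0 : E) 1, g x * truncatedPower α ε ‖x‖ ^ 2 / ‖x‖ ^ 2 ∂μ
      ≤ ∫ x in Metric.ball (0 : E) 1, g x * deriv (truncatedPower α ε) ‖x‖ ^ 2 ∂μ) :
    δ * ∫ x in Metric.ball (0 : E) (1 / 2) \ Metric.ball 0 ε, g x * ‖x‖ ^ (-2 * α) ∂μ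
      ≤ (1 + δ) * (4 ^ α) ^ 2 *
        ∫ x in Metric.ball (0 : E) (1 / 2) \ Metric.ball 0 (1 / 4), g x ∂μ := by
  set η := truncatedPower α ε with hη
  set A := Metric.ball (0 : E) (1 / 2) \ Metric.ball 0 ε with hA
  set A' := Metric.ball (0 : E) (1 / 2) \ Metric.ball 0 (1 / 4) with hA'
  have hAm : MeasurableSet A := measurableSet_ball.diff measurableSet_ball
  have hAm' : MeasurableSet A' := measurableSet_ball.diff measurableSet_ball
  have hball : Metric.ball (0 : E) (1 / 2) ⊆ Metric.ball 0 1 :=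
    Metric.ball_subset_ball (by norm_num)
  have hsub : A ⊆ Metric.ball 0 1 := Set.sdiff_subset.trans hball
  have hsub' : A' ⊆ Metric.ball 0 1 := Set.sdiff_subset.trans hball
  obtain ⟨K, hK⟩ := truncatedPower.lipschitz (α := α) hε
  have hη0 : η 0 = 0 := by
    rw [hη, truncatedPower.of_le_eps hε hε' hε.le, mul_zero]
  have hgi : IntegrableOn g (Metric.ball 0 1) μ :=
    (hg.continuousOn.integrableOn_compact (isCompact_closedBall (0 : E) 1)).mono_set
      Metric.ball_subset_closedBall
  have hi₁ : IntegrableOn (fun x => g x * (η ‖x‖ ^ 2 / ‖x‖ ^ 2)) (Metric.ball 0 1) μ := by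
    refine Integrable.mul_bdd (c := (K : ℝ) ^ 2) hgi ?_ (Filter.Eventually.of_forall fun x => ?_)
    · have : Measurable η := hK.continuous.measurable
      exact (((this.comp measurable_norm).pow_const 2).div
        (measurable_norm.pow_const 2)).aestronglyMeasurable
    · have h := hK.dist_le_mul ‖x‖ 0
      rw [← hη, hη0, dist_zero_right, dist_zero_right, norm_norm] at h
      rw [← div_pow, norm_pow, norm_div, norm_norm]
      exact pow_le_pow_left₀ (by positivity)
        (div_le_of_le_mul₀ (norm_nonneg _) K.2 h) 2
  have hi₂ : IntegrableOn (fun x => g x * deriv η ‖x‖ ^ 2) (Metric.ball 0 1) μ := by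
    refine Integrable.mul_bdd (c := (K : ℝ) ^ 2) hgi ?_ (Filter.Eventually.of_forall fun x => ?_)
    · exact (((measurable_deriv η).comp measurable_norm).pow_const 2).aestronglyMeasurable
    · rw [norm_pow]
      exact pow_le_pow_left₀ (norm_nonneg _) (norm_deriv_le_of_lipschitz hK) 2
  have hi₃ : IntegrableOn (A.indicator fun x => g x * ‖x‖ ^ (-2 * α)) (Metric.ball 0 1) μ :=
    ((integrable_indicator_iff hAm).2 (hint.mono_set Set.sdiff_subset)).integrableOn
  have hi₄ : IntegrableOn (A'.indicator g) (Metric.ball 0 1) μ :=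
    ((integrable_indicator_iff hAm').2 (hgi.mono_set hsub')).integrableOn
  have hmono : ∫ x in Metric.ball (0 : E) 1, (δ * A.indicator (fun x => g x * ‖x‖ ^ (-2 * α)) x
        - (1 + δ) * (4 ^ α) ^ 2 * A'.indicator g x) ∂μ
      ≤ ∫ x in Metric.ball (0 : E) 1, (m * (g x * (η ‖x‖ ^ 2 / ‖x‖ ^ 2))
        - g x * deriv η ‖x‖ ^ 2) ∂μ := by
    refine integral_mono_ae ((hi₃.const_mul _).sub (hi₄.const_mul _))
      ((hi₁.const_mul _).sub hi₂) (ae_restrict_of_ae ?_)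
    filter_upwards [ae_norm_ne μ 0, ae_norm_ne μ ε, ae_norm_ne μ (1 / 4), ae_norm_ne μ (1 / 2)]
      with x h₀ h₁ h₂ h₃
    have hp := mul_le_mul_of_nonneg_left
      (truncatedPower.pointwise_bound hm hδ hδm hα hε hε'
        ((norm_nonneg x).lt_of_ne' h₀) h₁ h₂ h₃) (hg0 x)
    have hmA : x ∈ A ↔ ε ≤ ‖x‖ ∧ ‖x‖ < 1 / 2 := by
      simp only [hA, Set.mem_sdiff, mem_ball_zero_iff, not_lt, and_comm]
    have hmA' : x ∈ A' ↔ 1 / 4 ≤ ‖x‖ ∧ ‖x‖ < 1 / 2 := by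
      simp only [hA', Set.mem_sdiff, mem_ball_zero_iff, not_lt, and_comm]
    classical
    simp only [Set.indicator_apply, hmA, hmA']
    refine le_trans (le_of_eq ?_) (hp.trans (le_of_eq ?_))
    · split_ifs <;> ring
    · ring
  rw [integral_sub (hi₃.const_mul _) (hi₄.const_mul _), integral_sub (hi₁.const_mul _) hi₂,
    integral_const_mul, integral_const_mul, integral_const_mul, setIntegral_indicator hAm,
    setIntegral_indicator hAm', Set.inter_eq_self_of_subset_right hsub,
    Set.inter_eq_self_of_subset_right hsub'] at hmono
  simp only [mul_div_assoc] at hstab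
  linarith

/-- Radial weighted estimate: if u(x) = U(|x|) on B₁ ⊂ ℝⁿ satisfies the
radial stability inequality
(n-1)∫_{B₁} u_r² η²/r² dx ≤ ∫_{B₁} u_r² |∇η|² dx
for every Lipschitz radial test function η vanishing at r = 1, and
1 ≤ α < 1 + √(n-1), then ∫_{B_{1/2}} u_r² r^{-2α} ≤ C(α,n) ∫_{B_{1/2}∖B_{1/4}} u_r². -/
theorem radial_weighted_estimate (n : ℕ) (hn : 2 ≤ n) (α : ℝ)
    (hα1 : 1 ≤ α) (hα2 : α < 1 + Real.sqrt ((n : ℝ) - 1)) :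
    ∃ C : ℝ, 0 < C ∧
      ∀ U : ℝ → ℝ, ContDiff ℝ (⊤ : ℕ∞) U →
        (∀ η : ℝ → ℝ, (∃ K : NNReal, LipschitzOnWith K η (Set.Icc 0 1)) →
          η 1 = 0 →
          ((n : ℝ) - 1) * ∫ x in Metric.ball (0 : EuclideanSpace ℝ (Fin n)) 1,
              (deriv U ‖x‖) ^ 2 * (η ‖x‖) ^ 2 / ‖x‖ ^ 2
            ≤ ∫ x in Metric.ball (0 : EuclideanSpace ℝ (Fin n)) 1,
                (deriv U ‖x‖) ^ 2 * (deriv η ‖x‖) ^ 2) →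
        (∫ x in Metric.ball (0 : EuclideanSpace ℝ (Fin n)) (1 / 2),
            (deriv U ‖x‖) ^ 2 * ‖x‖ ^ (-2 * α))
          ≤ C * ∫ x in Metric.ball (0 : EuclideanSpace ℝ (Fin n)) (1 / 2) \
                Metric.ball (0 : EuclideanSpace ℝ (Fin n)) (1 / 4),
              (deriv U ‖x‖) ^ 2 := by
  have hm : (1 : ℝ) ≤ (n : ℝ) - 1 := by
    have : (2 : ℝ) ≤ n := by exact_mod_cast hn
    linarith
  obtain ⟨δ, hδm⟩ : ∃ δ : ℝ, δ = (n : ℝ) - 1 - (α - 1) ^ 2 := ⟨_, rfl⟩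
  have hδ : 0 < δ := by
    have h := (Real.lt_sqrt (by linarith : 0 ≤ α - 1)).1 (by linarith : α - 1 < √((n : ℝ) - 1))
    linarith
  refine ⟨(1 + δ) * (4 ^ α) ^ 2 / δ, by positivity, fun U hU hstab => ?_⟩
  have : Nontrivial (Fin n) := Fin.nontrivial_iff_two_le.2 hn
  by_cases hint : IntegrableOn
      (fun x : EuclideanSpace ℝ (Fin n) => (deriv U ‖x‖) ^ 2 * ‖x‖ ^ (-2 * α))
      (Metric.ball 0 (1 / 2))
  swap
  · rw [integral_undef hint]
    exact mul_nonneg (by positivity) (integral_nonneg fun x => sq_nonneg _)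
  have hg : Continuous fun x : EuclideanSpace ℝ (Fin n) => (deriv U ‖x‖) ^ 2 :=
    ((hU.continuous_deriv (by simp)).comp continuous_norm).pow 2
  have hε : ∀ k : ℕ, (1 : ℝ) / (k + 5) < 1 / 4 := fun k =>
    one_div_lt_one_div_of_lt (by norm_num) (by have := k.cast_nonneg (α := ℝ); linarith)
  have hbound : ∀ k : ℕ,
      ∫ x in Metric.ball (0 : EuclideanSpace ℝ (Fin n)) (1 / 2) \ Metric.ball 0 (1 / (k + 5)),
        (deriv U ‖x‖) ^ 2 * ‖x‖ ^ (-2 * α)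
      ≤ (1 + δ) * (4 ^ α) ^ 2 / δ *
        ∫ x in Metric.ball (0 : EuclideanSpace ℝ (Fin n)) (1 / 2) \ Metric.ball 0 (1 / 4),
          (deriv U ‖x‖) ^ 2 := fun k => by
    have hpos : (0 : ℝ) < 1 / (k + 5) := by positivity
    obtain ⟨K, hK⟩ := truncatedPower.lipschitz (α := α) hpos
    have h := radial_weighted_estimate_annulus volume hm hδ.le hδm (by linarith) hpos (hε k) hg
      (fun x => sq_nonneg _) hint
      (hstab _ ⟨K, hK.lipschitzOnWith⟩ (truncatedPower.of_half_le (hε k) (by norm_num)))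
    rw [div_mul_eq_mul_div, le_div_iff₀ hδ, mul_comm]
    exact h
  have hUnion : ⋃ k : ℕ, Metric.ball (0 : EuclideanSpace ℝ (Fin n)) (1 / 2) \
      Metric.ball 0 (1 / ((k : ℝ) + 5)) = Metric.ball 0 (1 / 2) \ {0} := by
    rw [← Set.sdiff_iInter]
    congr 1
    ext x
    simp only [Set.mem_iInter, mem_ball_zero_iff, Set.mem_singleton_iff]
    refine ⟨fun h => ?_, fun h k => by rw [h, norm_zero]; positivity⟩
    by_contra hx
    obtain ⟨k, hk⟩ := exists_nat_one_div_lt (norm_pos_iff.2 hx)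
    have := one_div_le_one_div_of_le (by positivity) (by linarith : (k : ℝ) + 1 ≤ k + 5)
    linarith [h k]
  have hlim := tendsto_setIntegral_of_monotone (μ := volume)
    (f := fun x : EuclideanSpace ℝ (Fin n) => (deriv U ‖x‖) ^ 2 * ‖x‖ ^ (-2 * α))
    (s := fun k : ℕ => Metric.ball (0 : EuclideanSpace ℝ (Fin n)) (1 / 2) \
      Metric.ball 0 (1 / ((k : ℝ) + 5)))
    (fun k => measurableSet_ball.diff measurableSet_ball)
    (fun j k hjk => Set.sdiff_subset_sdiff_right (Metric.ball_subset_ball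
      (one_div_le_one_div_of_le (by positivity) (by gcongr))))
    (by rw [hUnion]; exact hint.mono_set Set.sdiff_subset)
  rw [hUnion, setIntegral_congr_set (sdiff_null_ae_eq_self (measure_singleton _))] at hlim
  exact le_of_tendsto' hlim hbound
end
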